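/- In the TIP alternating-interaction model with m ≥ 1 and n ≥ 0, set Ŝ^x = n·t^{xy}·ŝ^x, F̂^x = n·t^{xy}·f̂^x, S^x = m·s^x·r, F^x = m·f^x·r̄, Ŝ^y = m·t^{yx}·ŝ^y, F̂^y = m·t^{yx}·f̂^y, S^y = n·s^y·r, F^y = n·f^y·r̄. If S^x·F^y ≥ F^x·S^y, then the in-probability limits t^x and t^y of the trust processes T^x_k and T^y_k satisfy the system S^x·(1−t^x)/t^x = F̂^x·(t^x − t^y) + F^x and F^y·t^y/(1−t^y) = Ŝ^y·(t^x − t^y) + S^y. -/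

import Mathlib

open MeasureTheory Filter

/-- The Beta(a,b) probability measure on ℝ: the measure supported on (0,1) with density
`x ↦ x^(a−1)·(1−x)^(b−1) / B(a,b)` with respect to Lebesgue measure, where
`B(a,b) = Γ(a)·Γ(b)/Γ(a+b)`. -/
noncomputable def betaMeasure (a b : ℝ) : Measure ℝ :=
  volume.withDensity fun x =>
    ENNReal.ofReal
      (if 0 < x ∧ x < 1 then
        x ^ (a - 1) * (1 - x) ^ (b - 1) / (Real.Gamma a * Real.Gamma b / Real.Gamma (a + b))
      else 0)


lemma tip_betaMeasure_eq (a b : ℝ) : betaMeasure a b = ProbabilityTheory.betaMeasure a b := by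
  unfold betaMeasure ProbabilityTheory.betaMeasure
  congr 1
  ext x
  rw [ProbabilityTheory.betaPDF_eq]
  congr 2
  unfold ProbabilityTheory.beta
  ring

lemma tip_beta_prob {a b : ℝ} (ha : 0 < a) (hb : 0 < b) :
    IsProbabilityMeasure (betaMeasure a b) := by
  rw [tip_betaMeasure_eq]
  exact ProbabilityTheory.isProbabilityMeasureBeta ha hb

lemma tip_beta_compl (a b : ℝ) : betaMeasure a b (Set.Ioo 0 1)ᶜ = 0 := by
  unfold betaMeasure
  rw [withDensity_apply _ measurableSet_Ioo.compl]
  apply setLIntegral_eq_zero measurableSet_Ioo.compl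
  intro x hx
  have : ¬ (0 < x ∧ x < 1) := hx
  simp [this]

lemma tip_beta_mean_lint {a b : ℝ} (ha : 0 < a) (hb : 0 < b) :
    ∫⁻ x, ENNReal.ofReal x ∂(betaMeasure a b) = ENNReal.ofReal (a / (a + b)) := by
  rw [tip_betaMeasure_eq, ProbabilityTheory.betaMeasure,
    lintegral_withDensity_eq_lintegral_mul _
      (by unfold ProbabilityTheory.betaPDF; fun_prop) (by fun_prop)]
  have h : ∀ x, (ProbabilityTheory.betaPDF a b * fun x => ENNReal.ofReal x) x
      = ENNReal.ofReal (a / (a + b)) * ProbabilityTheory.betaPDF (a + 1) b x := by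
    intro x
    simp only [Pi.mul_apply, ProbabilityTheory.betaPDF_eq]
    by_cases hx : 0 < x ∧ x < 1
    · have hx0 := hx.1
      have hx1 : 0 < 1 - x := by linarith [hx.2]
      have hB := ProbabilityTheory.beta_pos ha hb
      have hG := Real.Gamma_pos_of_pos ha
      have hG2 := Real.Gamma_pos_of_pos hb
      have hG3 := Real.Gamma_pos_of_pos (add_pos ha hb)
      rw [if_pos hx, if_pos hx, ← ENNReal.ofReal_mul (by positivity),
        ← ENNReal.ofReal_mul (by positivity)]
      congr 1
      unfold ProbabilityTheory.beta
      have e1 : a + 1 + b = (a + b) + 1 := by ring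
      have e2 : a + 1 - 1 = (a - 1) + 1 := by ring
      rw [e1, Real.Gamma_add_one ha.ne', Real.Gamma_add_one (by positivity), e2,
        Real.rpow_add_one hx0.ne']
      field_simp
    · simp [hx]
  rw [lintegral_congr h, lintegral_const_mul _
    (by unfold ProbabilityTheory.betaPDF; fun_prop),
    ProbabilityTheory.lintegral_betaPDF_eq_one (by positivity) hb, mul_one]

lemma tip_gen {α : Type*} [MeasurableSpace α] (μ : Measure α) [IsProbabilityMeasure μ]
    (f : α → ℝ) (hf : Measurable f) (h01 : ∀ᵐ x ∂μ, f x ∈ Set.Ioo (0:ℝ) 1) (t ε : ℝ)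
    (hε : 0 < ε) :
    Integrable f μ ∧ Integrable (fun x => |f x - t|) μ ∧
    ∫ x, |f x - t| ∂μ ≤ ε + (1 + |t|) * (μ {x | ε < |f x - t|}).toReal := by
  have hint : Integrable f μ := by
    apply Integrable.of_bound hf.aestronglyMeasurable 1
    filter_upwards [h01] with x hx
    rw [Real.norm_eq_abs, abs_of_pos hx.1]; exact hx.2.le
  have hint2 : Integrable (fun x => |f x - t|) μ := (hint.sub (integrable_const t)).abs
  refine ⟨hint, hint2, ?_⟩
  have hS : MeasurableSet {x | ε < |f x - t|} := measurableSet_lt measurable_const (by fun_prop)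
  have hi : Integrable (fun x => {x | ε < |f x - t|}.indicator (fun _ => (1 + |t|)) x) μ :=
    (integrable_const _).indicator hS
  calc ∫ x, |f x - t| ∂μ ≤ ∫ x, (ε + {x | ε < |f x - t|}.indicator (fun _ => (1 + |t|)) x) ∂μ := by
        apply integral_mono_ae hint2 ((integrable_const _).add hi)
        filter_upwards [h01] with x hx
        by_cases h : ε < |f x - t|
        · have : x ∈ {x | ε < |f x - t|} := h
          simp only [Pi.add_apply, Set.indicator_of_mem this]
          have := abs_sub (f x) t
          rw [abs_of_pos hx.1] at this
          linarith [hx.2]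
        · have : x ∉ {x | ε < |f x - t|} := h
          simp only [Pi.add_apply, Set.indicator_of_notMem this]
          linarith
    _ = _ := by
        rw [integral_add (integrable_const _) hi, integral_indicator hS]
        simp [Measure.real, mul_comm]

lemma tip_beta_bound {a b : ℝ} (ha : 0 < a) (hb : 0 < b) (t ε : ℝ) (hε : 0 < ε) :
    |a / (a + b) - t| ≤ ε + (1 + |t|) * (betaMeasure a b {x | ε < |x - t|}).toReal := by
  have := tip_beta_prob ha hb
  have h01 : ∀ᵐ x ∂(betaMeasure a b), x ∈ Set.Ioo (0:ℝ) 1 := tip_beta_compl a b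
  obtain ⟨h1, h2, h3⟩ := tip_gen (betaMeasure a b) (fun x => x) measurable_id h01 t ε hε
  have hmean : ∫ x, x ∂(betaMeasure a b) = a / (a + b) := by
    rw [integral_eq_lintegral_of_nonneg_ae _ h1.aestronglyMeasurable, tip_beta_mean_lint ha hb,
      ENNReal.toReal_ofReal (by positivity)]
    filter_upwards [h01] with x hx using hx.1.le
  refine le_trans ?_ h3
  have : a / (a + b) - t = ∫ x, (x - t) ∂(betaMeasure a b) := by
    rw [integral_sub h1 (integrable_const _), hmean]; simp
  rw [this]
  exact abs_integral_le_integral_abs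

lemma tip_law {Ω : Type*} (G : MeasurableSpace Ω) {m0 : MeasurableSpace Ω} (P : Measure Ω)
    [IsProbabilityMeasure P] (hG : G ≤ m0) (T : Ω → ℝ) (hT : Measurable T) (a b : Ω → ℝ)
    (A : Set ℝ) (hA : MeasurableSet A)
    (h : P[fun ω => A.indicator (fun _ => (1 : ℝ)) (T ω) | G]
        =ᵐ[P] fun ω => (betaMeasure (a ω) (b ω) A).toReal) :
    Integrable (fun ω => (betaMeasure (a ω) (b ω) A).toReal) P ∧
    ∫ ω, (betaMeasure (a ω) (b ω) A).toReal ∂P = (P {ω | T ω ∈ A}).toReal := by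
  refine ⟨integrable_condExp.congr h, ?_⟩
  rw [← integral_congr_ae h, integral_condExp hG]
  have : (fun ω => A.indicator (fun _ => (1 : ℝ)) (T ω))
      = (T ⁻¹' A).indicator (fun _ => (1:ℝ)) := by
    ext ω; rfl
  rw [this, integral_indicator (hT hA)]
  simp [Measure.real, Set.preimage]

/-- All facts about one step. -/
lemma tip_step {Ω : Type*} (G : MeasurableSpace Ω) {m0 : MeasurableSpace Ω} (P : Measure Ω)
    [IsProbabilityMeasure P] (hG : G ≤ m0) (T : Ω → ℝ) (hT : Measurable T) (a b : Ω → ℝ)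
    (ham : Measurable a) (hbm : Measurable b)
    (ha : ∀ ω, 0 < a ω) (hb : ∀ ω, 0 < b ω)
    (h : ∀ A : Set ℝ, MeasurableSet A → P[fun ω => A.indicator (fun _ => (1 : ℝ)) (T ω) | G]
        =ᵐ[P] fun ω => (betaMeasure (a ω) (b ω) A).toReal) (t : ℝ) :
    Integrable (fun ω => |T ω - t|) P ∧ Integrable (fun ω => |a ω / (a ω + b ω) - t|) P ∧
    ∀ ε > 0, ∫ ω, |T ω - t| ∂P ≤ ε + (1 + |t|) * (P {ω | ε < |T ω - t|}).toReal ∧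
      ∫ ω, |a ω / (a ω + b ω) - t| ∂P ≤ ε + (1 + |t|) * (P {ω | ε < |T ω - t|}).toReal := by
  have h01 : ∀ᵐ ω ∂P, T ω ∈ Set.Ioo (0:ℝ) 1 := by
    have := (tip_law G P hG T hT a b (Set.Ioo 0 1)ᶜ measurableSet_Ioo.compl
      (h _ measurableSet_Ioo.compl)).2
    simp only [tip_beta_compl] at this
    simp only [ENNReal.toReal_zero, integral_zero] at this
    have := this.symm
    rw [ENNReal.toReal_eq_zero_iff] at this
    rcases this with h | h
    · exact h
    · exact absurd h (measure_ne_top _ _)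
  have hint : Integrable (fun ω => |a ω / (a ω + b ω) - t|) P := by
    apply Integrable.of_bound (Measurable.aestronglyMeasurable (by fun_prop)) (1 + |t|)
    refine Eventually.of_forall fun ω => ?_
    have h1 := ha ω
    have h2 := hb ω
    rw [Real.norm_eq_abs, abs_abs]
    have := abs_sub (a ω / (a ω + b ω)) t
    have h3 : a ω / (a ω + b ω) ≤ 1 := by rw [div_le_one (by positivity)]; linarith
    rw [abs_of_pos (by positivity : 0 < a ω / (a ω + b ω))] at this
    linarith
  refine ⟨(tip_gen P T hT h01 t 1 one_pos).2.1, hint, fun ε hε =>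
    ⟨(tip_gen P T hT h01 t ε hε).2.2, ?_⟩⟩
  have hS : MeasurableSet {x : ℝ | ε < |x - t|} :=
    measurableSet_lt measurable_const (by fun_prop)
  obtain ⟨hi, he⟩ := tip_law G P hG T hT a b _ hS (h _ hS)
  calc _ ≤ ∫ ω, (ε + (1 + |t|) * (betaMeasure (a ω) (b ω) {x : ℝ | ε < |x - t|}).toReal) ∂P := by
        apply integral_mono hint ((integrable_const _).add (hi.const_mul _))
        intro ω
        exact tip_beta_bound (ha ω) (hb ω) t ε hε
    _ = _ := by
        rw [integral_add (integrable_const _) (hi.const_mul _), integral_const_mul, he]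
        simp

lemma tip_tendsto {u : ℕ → ℝ} {p : ℝ → ℕ → ENNReal} (C : ℝ) (hu : ∀ k, 0 ≤ u k)
    (hp : ∀ ε > 0, Tendsto (p ε) atTop (nhds 0))
    (h : ∀ k, ∀ ε > 0, u k ≤ ε + C * (p ε k).toReal) : Tendsto u atTop (nhds 0) := by
  rw [Metric.tendsto_atTop]
  intro δ hδ
  have h1 := (ENNReal.tendsto_toReal ENNReal.zero_ne_top).comp (hp (δ/2) (by positivity))
  have h2 : Tendsto (fun k => δ/2 + C * (p (δ/2) k).toReal) atTop (nhds (δ/2 + C * 0)) :=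
    tendsto_const_nhds.add (h1.const_mul C)
  have h3 := h2.eventually_lt_const (by linarith : δ/2 + C * 0 < δ)
  obtain ⟨N, hN⟩ := eventually_atTop.1 h3
  refine ⟨N, fun k hk => ?_⟩
  rw [Real.dist_eq, sub_zero, abs_of_nonneg (hu k)]
  exact lt_of_le_of_lt (h k _ (by positivity)) (hN k hk)

lemma tip_sum (m n : ℕ) (p q : ℝ) (N : ℕ) :
    ∑ j ∈ Finset.range (N * (m + n)), (if j % (m + n) < m then p else q) = N * (m * p + n * q) := by
  induction N with
  | zero => simp
  | succ N ih =>
    rw [Nat.succ_mul, Finset.sum_range_add, ih, Finset.sum_range_add]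
    have h1 : ∑ x ∈ Finset.range m, (if (N * (m + n) + x) % (m + n) < m then p else q)
        = m * p := by
      rw [Finset.sum_congr rfl (g := fun _ => p)]
      · simp
      · intro x hx
        have hx := Finset.mem_range.1 hx
        rw [Nat.mul_add_mod_self_right, Nat.mod_eq_of_lt (by omega), if_pos hx]
    have h2 : ∑ x ∈ Finset.range n, (if (N * (m + n) + (m + x)) % (m + n) < m then p else q)
        = n * q := by
      rw [Finset.sum_congr rfl (g := fun _ => q)]
      · simp
      · intro x hx
        have hx := Finset.mem_range.1 hx
        rw [Nat.mul_add_mod_self_right, Nat.mod_eq_of_lt (by omega), if_neg (by omega)]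
    rw [h1, h2]
    push_cast
    ring

lemma tip_det (m n : ℕ) (hm : 1 ≤ m) (a e : ℕ → ℝ) (p q C : ℝ) (hC : 0 ≤ C)
    (he : ∀ k, 0 ≤ e k)
    (h : ∀ k, |a (k + 2) - a (k + 1) - (if (k + 1) % (m + n) < m then p else q)|
      ≤ C * (e (k + 1) + e k))
    (φ : ℕ → ℕ) (hφ : Tendsto φ atTop atTop)
    (hlim : Tendsto (fun i => (φ i : ℝ)⁻¹ * ∑ j ∈ Finset.range (φ i * (m + n)), e j) atTop (nhds 0)) :
    Tendsto (fun i => (φ i : ℝ)⁻¹ * a (φ i * (m + n))) atTop (nhds (m * p + n * q)) := by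
  set c : ℕ → ℝ := fun j => if j % (m + n) < m then p else q with hc
  have key : ∀ M, |a (M + 1) - a 1 - ∑ j ∈ Finset.range M, c (j + 1)|
      ≤ 2 * C * ∑ j ∈ Finset.range M, e j + C * e M := by
    intro M
    induction M with
    | zero => simp; exact mul_nonneg hC (he 0)
    | succ M ih =>
      rw [Finset.sum_range_succ, Finset.sum_range_succ]
      have h' := h M
      have := abs_add_le (a (M + 1) - a 1 - ∑ j ∈ Finset.range M, c (j + 1))
        (a (M + 2) - a (M + 1) - c (M + 1))
      have e1 : a (M + 1 + 1) - a 1 - (∑ j ∈ Finset.range M, c (j + 1) + c (M + 1))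
        = (a (M + 1) - a 1 - ∑ j ∈ Finset.range M, c (j + 1)) +
        (a (M + 2) - a (M + 1) - c (M + 1)) := by ring_nf
      rw [e1]
      refine this.trans ?_
      refine (add_le_add ih h').trans ?_
      linarith
  have key2 : ∀ N : ℕ, 1 ≤ N → |a (N * (m + n)) - (a 1 - c 0) - N * (m * p + n * q)|
      ≤ 2 * C * ∑ j ∈ Finset.range (N * (m + n)), e j := by
    intro N hN
    obtain ⟨M, hM⟩ : ∃ M, N * (m + n) = M + 1 :=
      ⟨N * (m + n) - 1, by have : 0 < N * (m + n) := by positivity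
                           omega⟩
    have hs := tip_sum m n p q N
    rw [← hs, hM, Finset.sum_range_succ', Finset.sum_range_succ]
    have := key M
    have h2 := mul_nonneg hC (he M)
    simp only [hc] at this ⊢
    rw [show ∀ x y z w : ℝ, x - (y - w) - (z + w) = x - y - z by intros; ring]
    linarith
  have hinv : Tendsto (fun i => (φ i : ℝ)⁻¹) atTop (nhds 0) :=
    tendsto_inv_atTop_zero.comp (tendsto_natCast_atTop_atTop.comp hφ)
  have h1 : Tendsto (fun i => (φ i : ℝ)⁻¹ * a (φ i * (m + n))
      - (φ i : ℝ)⁻¹ * (a 1 - c 0) - (m * p + n * q)) atTop (nhds 0) := by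
    apply squeeze_zero_norm' _ (by simpa using hlim.const_mul (2 * C))
    filter_upwards [hφ.eventually_ge_atTop 1] with i hi
    have hpos : (0:ℝ) < φ i := by exact_mod_cast hi
    have e1 : (φ i : ℝ)⁻¹ * a (φ i * (m + n)) - (φ i : ℝ)⁻¹ * (a 1 - c 0) - (m * p + n * q)
      = (φ i : ℝ)⁻¹ * (a (φ i * (m + n)) - (a 1 - c 0) - φ i * (m * p + n * q)) := by
      field_simp
    rw [e1, Real.norm_eq_abs, abs_mul, abs_of_pos (inv_pos.2 hpos)]
    have := mul_le_mul_of_nonneg_left (key2 _ hi) (inv_pos.2 hpos).le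
    linarith
  have h2 := (h1.add (hinv.mul_const (a 1 - c 0))).add_const (m * p + n * q)
  simp only [zero_mul, zero_add, add_zero] at h2
  refine h2.congr fun i => ?_
  ring

lemma tip_eq (a b : ℕ → ℝ) (ha : ∀ k, 0 < a k) (hb : ∀ k, 0 < b k) (φ s : ℕ → ℕ)
    (A B t : ℝ) (h1 : Tendsto (fun i => (φ i : ℝ)⁻¹ * a (s i)) atTop (nhds A))
    (h2 : Tendsto (fun i => (φ i : ℝ)⁻¹ * b (s i)) atTop (nhds B))
    (h3 : Tendsto (fun i => a (s i) / (a (s i) + b (s i))) atTop (nhds t)) :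
    A = t * (A + B) := by
  refine tendsto_nhds_unique h1 ((h3.mul (h1.add h2)).congr fun i => ?_)
  have := ha (s i)
  have := hb (s i)
  field_simp

lemma tip_ae_subseq {Ω : Type*} {m0 : MeasurableSpace Ω} (P : Measure Ω) [IsProbabilityMeasure P]
    (Z : ℕ → Ω → ℝ) (hZ : ∀ N, Integrable (Z N) P) (hZ0 : ∀ N ω, 0 ≤ Z N ω)
    (h : Tendsto (fun N => ∫ ω, Z N ω ∂P) atTop (nhds 0)) :
    ∃ φ : ℕ → ℕ, StrictMono φ ∧ ∃ ω, Tendsto (fun i => Z (φ i) ω) atTop (nhds 0) := by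
  have h1 : TendstoInMeasure P Z atTop (fun _ => (0:ℝ)) := by
    apply tendstoInMeasure_of_tendsto_eLpNorm (p := 1) one_ne_zero
      (fun N => (hZ N).aestronglyMeasurable) aestronglyMeasurable_const
    have : ∀ N, eLpNorm (Z N - fun _ => (0:ℝ)) 1 P = ENNReal.ofReal (∫ ω, Z N ω ∂P) := by
      intro N
      have e : (Z N - fun _ => (0:ℝ)) = Z N := by ext; simp
      rw [e, eLpNorm_one_eq_lintegral_enorm, ← ofReal_integral_norm_eq_lintegral_enorm (hZ N)]
      congr 1
      apply integral_congr_ae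
      exact Eventually.of_forall fun ω => by simp [abs_of_nonneg (hZ0 N ω)]
    simp only [this]
    simpa using ENNReal.tendsto_ofReal h
  obtain ⟨φ, hφ, hae⟩ := h1.exists_seq_tendsto_ae
  obtain ⟨ω, hω⟩ := hae.exists
  exact ⟨φ, hφ, ω, hω⟩

lemma tip_max (c u v u0 v0 : ℝ) (hc : 0 ≤ c) :
    |c * max (u - v) 0 - c * max (u0 - v0) 0| ≤ c * (|u - u0| + |v - v0|) := by
  rw [← mul_sub, abs_mul, abs_of_nonneg hc]
  apply mul_le_mul_of_nonneg_left _ hc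
  refine (abs_max_sub_max_le_abs _ _ _).trans ?_
  have := abs_sub (u - u0) (v - v0)
  rwa [show u - v - (u0 - v0) = (u - u0) - (v - v0) by ring]

lemma tip_alg (Sx Fx Sy Fy sxh fxh syh fyh tx ty : ℝ) (hSx : 0 < Sx) (hFx : 0 < Fx)
    (hy : (Sy = 0 ∧ Fy = 0) ∨ (0 < Sy ∧ 0 < Fy)) (hsxh : 0 ≤ sxh) (hfxh : 0 ≤ fxh)
    (hsyh : 0 < syh) (hfyh : 0 < fyh) (hcase : Sx * Fy ≥ Fx * Sy)
    (h1 : Sx + sxh * max (ty - tx) 0 = tx * (Sx + sxh * max (ty - tx) 0 + (Fx + fxh * max (tx - ty) 0)))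
    (h2 : syh * max (tx - ty) 0 + Sy =
      ty * (syh * max (tx - ty) 0 + Sy + (fyh * max (ty - tx) 0 + Fy))) :
    Sx * ((1 - tx) / tx) = fxh * (tx - ty) + Fx ∧ Fy * (ty / (1 - ty)) = syh * (tx - ty) + Sy := by
  have hA : 0 < Sx + sxh * max (ty - tx) 0 := by positivity
  have hB : 0 < Fx + fxh * max (tx - ty) 0 := by positivity
  have htx0 : 0 < tx := by
    by_contra h
    push Not at h
    nlinarith [mul_nonneg (neg_nonneg.2 h) (add_pos hA hB).le]
  have htx1 : tx < 1 := by
    by_contra h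
    push Not at h
    nlinarith [mul_nonneg (sub_nonneg.2 h) (add_pos hA hB).le]
  have hle : ty ≤ tx := by
    by_contra h
    push Not at h
    rw [max_eq_left (a := ty - tx) (by linarith), max_eq_right (a := tx - ty) (by linarith)] at h1 h2
    have h1' : tx * Fx = (1 - tx) * (Sx + sxh * (ty - tx)) := by linarith
    have h2' : ty * (fyh * (ty - tx) + Fy) = (1 - ty) * Sy := by linarith
    have hge : (1 - tx) * Sx ≤ tx * Fx := by
      have : 0 ≤ (1 - tx) * (sxh * (ty - tx)) :=
        mul_nonneg (by linarith) (mul_nonneg hsxh (by linarith))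
      linarith
    have hty : 0 < ty := by linarith
    have hp : 0 < ty * (fyh * (ty - tx)) := mul_pos hty (mul_pos hfyh (by linarith))
    rcases hy with ⟨e1, e2⟩ | ⟨e1, e2⟩
    · subst e1 e2; linarith
    · have hlt : ty * Fy < (1 - ty) * Sy := by linarith
      have hd : tx * Sy < ty * Sy := mul_lt_mul_of_pos_right h e1
      have hd' : tx * Fy < ty * Fy := mul_lt_mul_of_pos_right h e2
      have hlt' : tx * Fy < (1 - tx) * Sy := by linarith
      -- tx Fy < (1-tx) Sy and (1-tx) Sx ≤ tx Fx
      have i1 : Sx * (tx * Fy) < Sx * ((1 - tx) * Sy) := mul_lt_mul_of_pos_left hlt' hSx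
      have i2 : ((1 - tx) * Sx) * Sy ≤ (tx * Fx) * Sy := mul_le_mul_of_nonneg_right hge e1.le
      have i3 : tx * (Fx * Sy) ≤ tx * (Sx * Fy) := mul_le_mul_of_nonneg_left hcase htx0.le
      linarith
  rw [max_eq_right (a := ty - tx) (by linarith), max_eq_left (a := tx - ty) (by linarith)] at h1 h2
  constructor
  · field_simp
    linarith
  · rcases hy with ⟨e1, e2⟩ | ⟨e1, e2⟩
    · subst e1 e2
      have h3 : (1 - ty) * (syh * (tx - ty)) = 0 := by linarith
      have h4 : (1 - ty) ≠ 0 := by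
        intro h; linarith
      have := (mul_eq_zero.1 h3).resolve_left h4
      linarith
    · have h4 : (1 - ty) ≠ 0 := by
        intro h; linarith
      field_simp
      linarith

/-- **Equilibrium equations for the limiting trust values in the TIP model (case
`Sˣ·Fʸ ≥ Fˣ·Sʸ`).** If `tx` and `ty` are the in-probability limits of the trust
processes `Tx` and `Ty`, then they satisfy the system
`Sˣ·(1−tx)/tx = F̂ˣ·(tx−ty) + Fˣ` and `Fʸ·ty/(1−ty) = Ŝʸ·(tx−ty) + Sʸ`. -/
theorem tip_equilibrium_case1
    {Ω : Type*} [MeasurableSpace Ω] (P : Measure Ω) [IsProbabilityMeasure P]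
    (ℱ : Filtration ℕ ‹MeasurableSpace Ω›)
    -- parameters
    (r : ℝ) (hr : r ∈ Set.Ioo (0 : ℝ) 1)
    (m n : ℕ) (hm : 1 ≤ m)
    (sx fx sy fy : ℝ) (hsx : 0 < sx) (hfx : 0 < fx) (hsy : 0 < sy) (hfy : 0 < fy)
    (sxh fxh syh fyh : ℝ) (hsxh : 0 < sxh) (hfxh : 0 < fxh) (hsyh : 0 < syh) (hfyh : 0 < fyh)
    (txy tyx : ℝ) (htxy : txy ∈ Set.Ioc (0 : ℝ) 1) (htyx : tyx ∈ Set.Ioc (0 : ℝ) 1)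
    (ax0 bx0 ay0 by0 : ℝ) (hax0 : 0 < ax0) (hbx0 : 0 < bx0) (hay0 : 0 < ay0) (hby0 : 0 < by0)
    -- processes
    (ax bx ay bY : ℕ → Ω → ℝ) (Tx Ty : ℕ → Ω → ℝ)
    (hax_init : ∀ ω, ax 0 ω = ax0) (hbx_init : ∀ ω, bx 0 ω = bx0)
    (hay_init : ∀ ω, ay 0 ω = ay0) (hbY_init : ∀ ω, bY 0 ω = by0)
    -- all processes are adapted to the filtration
    (hax_adapted : Adapted ℱ ax) (hbx_adapted : Adapted ℱ bx)
    (hay_adapted : Adapted ℱ ay) (hbY_adapted : Adapted ℱ bY)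
    (hTx_adapted : Adapted ℱ Tx) (hTy_adapted : Adapted ℱ Ty)
    -- update equations at x-steps: x updates directly, y indirectly
    (hxstep : ∀ k, 1 ≤ k → (k - 1) % (m + n) < m → ∀ ω,
      ax k ω = ax (k - 1) ω + sx * r ∧
      bx k ω = bx (k - 1) ω + fx * (1 - r) ∧
      ay k ω = ay (k - 1) ω + syh * tyx * max (Tx k ω - Ty (k - 1) ω) 0 ∧
      bY k ω = bY (k - 1) ω + fyh * tyx * max (Ty (k - 1) ω - Tx k ω) 0)
    -- update equations at y-steps: y updates directly, x indirectly
    (hystep : ∀ k, 1 ≤ k → ¬ (k - 1) % (m + n) < m → ∀ ω,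
      ay k ω = ay (k - 1) ω + sy * r ∧
      bY k ω = bY (k - 1) ω + fy * (1 - r) ∧
      ax k ω = ax (k - 1) ω + sxh * txy * max (Ty k ω - Tx (k - 1) ω) 0 ∧
      bx k ω = bx (k - 1) ω + fxh * txy * max (Tx (k - 1) ω - Ty k ω) 0)
    -- at an x-step, the conditional distribution of `Tx k` given the past is
    -- Beta(ax k, bx k), and that of `Ty k` given the past and `Tx k` is Beta(ay k, bY k)
    (hTx_condLaw_xstep : ∀ k, 1 ≤ k → (k - 1) % (m + n) < m → ∀ A : Set ℝ, MeasurableSet A →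
      P[fun ω => A.indicator (fun _ => (1 : ℝ)) (Tx k ω) | ℱ (k - 1)]
        =ᵐ[P] fun ω => (betaMeasure (ax k ω) (bx k ω) A).toReal)
    (hTy_condLaw_xstep : ∀ k, 1 ≤ k → (k - 1) % (m + n) < m → ∀ A : Set ℝ, MeasurableSet A →
      P[fun ω => A.indicator (fun _ => (1 : ℝ)) (Ty k ω)
          | (ℱ (k - 1) : MeasurableSpace Ω) ⊔ MeasurableSpace.comap (Tx k) inferInstance]
        =ᵐ[P] fun ω => (betaMeasure (ay k ω) (bY k ω) A).toReal)
    -- at a y-step, symmetrically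
    (hTy_condLaw_ystep : ∀ k, 1 ≤ k → ¬ (k - 1) % (m + n) < m → ∀ A : Set ℝ, MeasurableSet A →
      P[fun ω => A.indicator (fun _ => (1 : ℝ)) (Ty k ω) | ℱ (k - 1)]
        =ᵐ[P] fun ω => (betaMeasure (ay k ω) (bY k ω) A).toReal)
    (hTx_condLaw_ystep : ∀ k, 1 ≤ k → ¬ (k - 1) % (m + n) < m → ∀ A : Set ℝ, MeasurableSet A →
      P[fun ω => A.indicator (fun _ => (1 : ℝ)) (Tx k ω)
          | (ℱ (k - 1) : MeasurableSpace Ω) ⊔ MeasurableSpace.comap (Ty k) inferInstance]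
        =ᵐ[P] fun ω => (betaMeasure (ax k ω) (bx k ω) A).toReal)
    -- `tx` and `ty` are the in-probability limits of the trust processes
    (tx ty : ℝ)
    (htx_lim : ∀ ε > 0, Tendsto (fun k => P {ω | ε < |Tx k ω - tx|}) atTop (nhds 0))
    (hty_lim : ∀ ε > 0, Tendsto (fun k => P {ω | ε < |Ty k ω - ty|}) atTop (nhds 0))
    -- case condition: `Sˣ·Fʸ ≥ Fˣ·Sʸ`
    (hcase : (m : ℝ) * sx * r * ((n : ℝ) * fy * (1 - r)) ≥
      (m : ℝ) * fx * (1 - r) * ((n : ℝ) * sy * r)) :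
    (m : ℝ) * sx * r * ((1 - tx) / tx) =
        (n : ℝ) * txy * fxh * (tx - ty) + (m : ℝ) * fx * (1 - r) ∧
      (n : ℝ) * fy * (1 - r) * (ty / (1 - ty)) =
        (m : ℝ) * tyx * syh * (tx - ty) + (n : ℝ) * sy * r := by
  have hr0 : 0 < r := hr.1
  have hr1 : 0 < 1 - r := by linarith [hr.2]
  have htxy0 : 0 < txy := htxy.1
  have htyx0 : 0 < tyx := htyx.1
  have hX : ∀ k, k % (m + n) < m → ∀ ω,
      ax (k + 1) ω = ax k ω + sx * r ∧
      bx (k + 1) ω = bx k ω + fx * (1 - r) ∧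
      ay (k + 1) ω = ay k ω + syh * tyx * max (Tx (k + 1) ω - Ty k ω) 0 ∧
      bY (k + 1) ω = bY k ω + fyh * tyx * max (Ty k ω - Tx (k + 1) ω) 0 :=
    fun k hk => hxstep (k + 1) (by omega) (by simpa using hk)
  have hY : ∀ k, ¬ k % (m + n) < m → ∀ ω,
      ay (k + 1) ω = ay k ω + sy * r ∧
      bY (k + 1) ω = bY k ω + fy * (1 - r) ∧
      ax (k + 1) ω = ax k ω + sxh * txy * max (Ty (k + 1) ω - Tx k ω) 0 ∧
      bx (k + 1) ω = bx k ω + fxh * txy * max (Tx k ω - Ty (k + 1) ω) 0 :=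
    fun k hk => hystep (k + 1) (by omega) (by simpa using hk)
  have hpos : ∀ k ω, 0 < ax k ω ∧ 0 < bx k ω ∧ 0 < ay k ω ∧ 0 < bY k ω := by
    intro k ω
    induction k with
    | zero => rw [hax_init, hbx_init, hay_init, hbY_init]; exact ⟨hax0, hbx0, hay0, hby0⟩
    | succ k ih =>
      obtain ⟨i1, i2, i3, i4⟩ := ih
      by_cases hk : k % (m + n) < m
      · obtain ⟨h1, h2, h3, h4⟩ := hX k hk ω
        rw [h1, h2, h3, h4]
        refine ⟨?_, ?_, ?_, ?_⟩ <;> positivity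
      · obtain ⟨h1, h2, h3, h4⟩ := hY k hk ω
        rw [h1, h2, h3, h4]
        refine ⟨?_, ?_, ?_, ?_⟩ <;> positivity
  have maxm : ∀ k, Measurable (ax k) := fun k => (hax_adapted k).mono (ℱ.le k) le_rfl
  have mbx : ∀ k, Measurable (bx k) := fun k => (hbx_adapted k).mono (ℱ.le k) le_rfl
  have may : ∀ k, Measurable (ay k) := fun k => (hay_adapted k).mono (ℱ.le k) le_rfl
  have mbY : ∀ k, Measurable (bY k) := fun k => (hbY_adapted k).mono (ℱ.le k) le_rfl
  have mTx : ∀ k, Measurable (Tx k) := fun k => (hTx_adapted k).mono (ℱ.le k) le_rfl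
  have mTy : ∀ k, Measurable (Ty k) := fun k => (hTy_adapted k).mono (ℱ.le k) le_rfl
  have stepx : ∀ k, Integrable (fun ω => |Tx (k + 1) ω - tx|) P ∧
      Integrable (fun ω => |ax (k + 1) ω / (ax (k + 1) ω + bx (k + 1) ω) - tx|) P ∧
      ∀ ε > 0, ∫ ω, |Tx (k + 1) ω - tx| ∂P
          ≤ ε + (1 + |tx|) * (P {ω | ε < |Tx (k + 1) ω - tx|}).toReal ∧
        ∫ ω, |ax (k + 1) ω / (ax (k + 1) ω + bx (k + 1) ω) - tx| ∂P
          ≤ ε + (1 + |tx|) * (P {ω | ε < |Tx (k + 1) ω - tx|}).toReal := by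
    intro k
    by_cases hk : k % (m + n) < m
    · exact tip_step _ P (ℱ.le _) _ (mTx _) _ _ (maxm _) (mbx _) (fun ω => (hpos _ ω).1)
        (fun ω => (hpos _ ω).2.1) (hTx_condLaw_xstep (k + 1) (by omega) (by simpa using hk)) tx
    · exact tip_step _ P (sup_le (ℱ.le _) (mTy _).comap_le) _ (mTx _) _ _ (maxm _) (mbx _)
        (fun ω => (hpos _ ω).1) (fun ω => (hpos _ ω).2.1)
        (hTx_condLaw_ystep (k + 1) (by omega) (by simpa using hk)) tx
  have stepy : ∀ k, Integrable (fun ω => |Ty (k + 1) ω - ty|) P ∧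
      Integrable (fun ω => |ay (k + 1) ω / (ay (k + 1) ω + bY (k + 1) ω) - ty|) P ∧
      ∀ ε > 0, ∫ ω, |Ty (k + 1) ω - ty| ∂P
          ≤ ε + (1 + |ty|) * (P {ω | ε < |Ty (k + 1) ω - ty|}).toReal ∧
        ∫ ω, |ay (k + 1) ω / (ay (k + 1) ω + bY (k + 1) ω) - ty| ∂P
          ≤ ε + (1 + |ty|) * (P {ω | ε < |Ty (k + 1) ω - ty|}).toReal := by
    intro k
    by_cases hk : k % (m + n) < m
    · exact tip_step _ P (sup_le (ℱ.le _) (mTx _).comap_le) _ (mTy _) _ _ (may _) (mbY _)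
        (fun ω => (hpos _ ω).2.2.1) (fun ω => (hpos _ ω).2.2.2)
        (hTy_condLaw_xstep (k + 1) (by omega) (by simpa using hk)) ty
    · exact tip_step _ P (ℱ.le _) _ (mTy _) _ _ (may _) (mbY _) (fun ω => (hpos _ ω).2.2.1)
        (fun ω => (hpos _ ω).2.2.2) (hTy_condLaw_ystep (k + 1) (by omega) (by simpa using hk)) ty
  have limx : ∀ ε > 0, Tendsto (fun k => P {ω | ε < |Tx (k + 1) ω - tx|}) atTop (nhds 0) :=
    fun ε hε => (htx_lim ε hε).comp (tendsto_add_atTop_nat 1)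
  have limy : ∀ ε > 0, Tendsto (fun k => P {ω | ε < |Ty (k + 1) ω - ty|}) atTop (nhds 0) :=
    fun ε hε => (hty_lim ε hε).comp (tendsto_add_atTop_nat 1)
  have uTx : Tendsto (fun k => ∫ ω, |Tx (k + 1) ω - tx| ∂P) atTop (nhds 0) :=
    tip_tendsto (1 + |tx|) (fun k => integral_nonneg fun ω => abs_nonneg _) limx
      (fun k ε hε => ((stepx k).2.2 ε hε).1)
  have uTy : Tendsto (fun k => ∫ ω, |Ty (k + 1) ω - ty| ∂P) atTop (nhds 0) :=
    tip_tendsto (1 + |ty|) (fun k => integral_nonneg fun ω => abs_nonneg _) limy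
      (fun k ε hε => ((stepy k).2.2 ε hε).1)
  have uRx : Tendsto (fun k => ∫ ω, |ax (k + 1) ω / (ax (k + 1) ω + bx (k + 1) ω) - tx| ∂P)
      atTop (nhds 0) :=
    tip_tendsto (1 + |tx|) (fun k => integral_nonneg fun ω => abs_nonneg _) limx
      (fun k ε hε => ((stepx k).2.2 ε hε).2)
  have uRy : Tendsto (fun k => ∫ ω, |ay (k + 1) ω / (ay (k + 1) ω + bY (k + 1) ω) - ty| ∂P)
      atTop (nhds 0) :=
    tip_tendsto (1 + |ty|) (fun k => integral_nonneg fun ω => abs_nonneg _) limy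
      (fun k ε hε => ((stepy k).2.2 ε hε).2)
  set e : ℕ → Ω → ℝ := fun k ω => |Tx (k + 1) ω - tx| + |Ty (k + 1) ω - ty| with he
  have e0 : ∀ k ω, 0 ≤ e k ω := fun k ω => by simp only [he]; positivity
  have ei : ∀ k, Integrable (e k) P := fun k => (stepx k).1.add (stepy k).1
  have ue : Tendsto (fun k => ∫ ω, e k ω ∂P) atTop (nhds 0) := by
    have := uTx.add uTy
    rw [add_zero] at this
    refine this.congr fun k => ?_
    rw [← integral_add (stepx k).1 (stepy k).1]
  -- index
  set s : ℕ → ℕ := fun N => (N + 1) * (m + n) with hs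
  have hs1 : ∀ N, s N - 1 + 1 = s N := fun N => by
    have : 0 < s N := by simp only [hs]; positivity
    omega
  have hslim : Tendsto s atTop atTop := by
    apply tendsto_atTop_mono (f := fun N => N) _ tendsto_id
    intro N
    simp only [hs]
    nlinarith
  have hslim' : Tendsto (fun N => s N - 1) atTop atTop := by
    apply tendsto_atTop_mono (f := fun N => N) _ tendsto_id
    intro N
    have : N + 1 ≤ s N := by simp only [hs]; nlinarith
    show N ≤ s N - 1
    omega
  have iRx : ∀ N, Integrable (fun ω => |ax (s N) ω / (ax (s N) ω + bx (s N) ω) - tx|) P := by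
    intro N
    have := (stepx (s N - 1)).2.1
    rwa [hs1] at this
  have iRy : ∀ N, Integrable (fun ω => |ay (s N) ω / (ay (s N) ω + bY (s N) ω) - ty|) P := by
    intro N
    have := (stepy (s N - 1)).2.1
    rwa [hs1] at this
  have vRx : Tendsto (fun N => ∫ ω, |ax (s N) ω / (ax (s N) ω + bx (s N) ω) - tx| ∂P)
      atTop (nhds 0) := by
    refine (uRx.comp hslim').congr fun N => ?_
    simp only [Function.comp, hs1]
  have vRy : Tendsto (fun N => ∫ ω, |ay (s N) ω / (ay (s N) ω + bY (s N) ω) - ty| ∂P)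
      atTop (nhds 0) := by
    refine (uRy.comp hslim').congr fun N => ?_
    simp only [Function.comp, hs1]
  have vW : Tendsto (fun N : ℕ => (((N + 1 : ℕ) : ℝ))⁻¹ * ∑ j ∈ Finset.range (s N), ∫ ω, e j ω ∂P)
      atTop (nhds 0) := by
    have := (ue.cesaro.comp hslim).const_mul ((m : ℝ) + n)
    rw [mul_zero] at this
    refine this.congr fun N => ?_
    simp only [Function.comp, hs]
    have hmn : (0 : ℝ) < m + n := by
      have : (1 : ℝ) ≤ m := by exact_mod_cast hm
      positivity
    push_cast
    field_simp
  set Z : ℕ → Ω → ℝ := fun N ω => |ax (s N) ω / (ax (s N) ω + bx (s N) ω) - tx|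
    + |ay (s N) ω / (ay (s N) ω + bY (s N) ω) - ty|
    + (((N + 1 : ℕ) : ℝ))⁻¹ * ∑ j ∈ Finset.range (s N), e j ω with hZ
  have iW : ∀ N, Integrable (fun ω => (((N + 1 : ℕ) : ℝ))⁻¹ * ∑ j ∈ Finset.range (s N), e j ω) P :=
    fun N => (integrable_finsetSum _ fun j _ => ei j).const_mul _
  have W0 : ∀ N ω, 0 ≤ (((N + 1 : ℕ) : ℝ))⁻¹ * ∑ j ∈ Finset.range (s N), e j ω := fun N ω =>
    mul_nonneg (by positivity) (Finset.sum_nonneg fun j _ => e0 j ω)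
  have iZ : ∀ N, Integrable (Z N) P := fun N => ((iRx N).add (iRy N)).add (iW N)
  have Z0 : ∀ N ω, 0 ≤ Z N ω := fun N ω =>
    add_nonneg (add_nonneg (abs_nonneg _) (abs_nonneg _)) (W0 N ω)
  have vZ : Tendsto (fun N => ∫ ω, Z N ω ∂P) atTop (nhds 0) := by
    have := (vRx.add vRy).add vW
    rw [add_zero, add_zero] at this
    refine this.congr fun N => ?_
    simp only [hZ]
    have h12 : Integrable (fun ω => |ax (s N) ω / (ax (s N) ω + bx (s N) ω) - tx|
        + |ay (s N) ω / (ay (s N) ω + bY (s N) ω) - ty|) P := (iRx N).add (iRy N)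
    rw [integral_add h12 (iW N), integral_add (iRx N) (iRy N),
      integral_const_mul, integral_finsetSum _ fun j _ => ei j]
  obtain ⟨φ, hφ, ω, hω⟩ := tip_ae_subseq P Z iZ Z0 vZ
  have lRx : Tendsto (fun i => ax (s (φ i)) ω / (ax (s (φ i)) ω + bx (s (φ i)) ω)) atTop
      (nhds tx) := by
    rw [tendsto_iff_dist_tendsto_zero]
    refine squeeze_zero (fun i => dist_nonneg) (fun i => ?_) hω
    rw [Real.dist_eq]
    have := W0 (φ i) ω
    have := abs_nonneg (ay (s (φ i)) ω / (ay (s (φ i)) ω + bY (s (φ i)) ω) - ty)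
    simp only [hZ]
    linarith
  have lRy : Tendsto (fun i => ay (s (φ i)) ω / (ay (s (φ i)) ω + bY (s (φ i)) ω)) atTop
      (nhds ty) := by
    rw [tendsto_iff_dist_tendsto_zero]
    refine squeeze_zero (fun i => dist_nonneg) (fun i => ?_) hω
    rw [Real.dist_eq]
    have := W0 (φ i) ω
    have := abs_nonneg (ax (s (φ i)) ω / (ax (s (φ i)) ω + bx (s (φ i)) ω) - tx)
    simp only [hZ]
    linarith
  have lW : Tendsto (fun i => (((φ i + 1 : ℕ) : ℝ))⁻¹ *
      ∑ j ∈ Finset.range ((φ i + 1) * (m + n)), e j ω) atTop (nhds 0) := by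
    refine squeeze_zero (fun i => W0 (φ i) ω) (fun i => ?_) hω
    have := abs_nonneg (ax (s (φ i)) ω / (ax (s (φ i)) ω + bx (s (φ i)) ω) - tx)
    have := abs_nonneg (ay (s (φ i)) ω / (ay (s (φ i)) ω + bY (s (φ i)) ω) - ty)
    simp only [hZ]
    linarith
  have hφ1 : Tendsto (fun i => φ i + 1) atTop atTop :=
    (tendsto_add_atTop_nat 1).comp hφ.tendsto_atTop
  have ez : ∀ k, 0 ≤ e (k + 1) ω + e k ω := fun k => add_nonneg (e0 _ _) (e0 _ _)
  have exy : ∀ k, |Tx (k + 2) ω - tx| + |Ty (k + 1) ω - ty| ≤ e (k + 1) ω + e k ω := by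
    intro k
    have h1 := abs_nonneg (Ty (k + 2) ω - ty)
    have h2 := abs_nonneg (Tx (k + 1) ω - tx)
    simp only [he]
    linarith
  have eyx : ∀ k, |Ty (k + 2) ω - ty| + |Tx (k + 1) ω - tx| ≤ e (k + 1) ω + e k ω := by
    intro k
    have h1 := abs_nonneg (Tx (k + 2) ω - tx)
    have h2 := abs_nonneg (Ty (k + 1) ω - ty)
    simp only [he]
    linarith
  have lax := tip_det m n hm (fun k => ax k ω) (fun k => e k ω) (sx * r)
    (sxh * txy * max (ty - tx) 0) (sxh * txy) (by positivity) (fun k => e0 k ω) (by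
      intro k
      by_cases hk : (k + 1) % (m + n) < m
      · rw [if_pos hk, (hX (k + 1) hk ω).1]
        rw [add_sub_cancel_left, sub_self, abs_zero]
        exact mul_nonneg (by positivity) (ez k)
      · rw [if_neg hk, (hY (k + 1) hk ω).2.2.1, add_sub_cancel_left]
        refine (tip_max _ _ _ _ _ (by positivity)).trans ?_
        exact mul_le_mul_of_nonneg_left (eyx k) (by positivity)) (fun i => φ i + 1) hφ1 lW
  have lbx := tip_det m n hm (fun k => bx k ω) (fun k => e k ω) (fx * (1 - r))
    (fxh * txy * max (tx - ty) 0) (fxh * txy) (by positivity) (fun k => e0 k ω) (by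
      intro k
      by_cases hk : (k + 1) % (m + n) < m
      · rw [if_pos hk, (hX (k + 1) hk ω).2.1]
        rw [add_sub_cancel_left, sub_self, abs_zero]
        exact mul_nonneg (by positivity) (ez k)
      · rw [if_neg hk, (hY (k + 1) hk ω).2.2.2, add_sub_cancel_left]
        refine (tip_max _ _ _ _ _ (by positivity)).trans ?_
        rw [add_comm |_|]
        exact mul_le_mul_of_nonneg_left (eyx k) (by positivity)) (fun i => φ i + 1) hφ1 lW
  have lay := tip_det m n hm (fun k => ay k ω) (fun k => e k ω)
    (syh * tyx * max (tx - ty) 0) (sy * r) (syh * tyx) (by positivity) (fun k => e0 k ω) (by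
      intro k
      by_cases hk : (k + 1) % (m + n) < m
      · rw [if_pos hk, (hX (k + 1) hk ω).2.2.1, add_sub_cancel_left]
        refine (tip_max _ _ _ _ _ (by positivity)).trans ?_
        exact mul_le_mul_of_nonneg_left (exy k) (by positivity)
      · rw [if_neg hk, (hY (k + 1) hk ω).1]
        rw [add_sub_cancel_left, sub_self, abs_zero]
        exact mul_nonneg (by positivity) (ez k)) (fun i => φ i + 1) hφ1 lW
  have lbY := tip_det m n hm (fun k => bY k ω) (fun k => e k ω)
    (fyh * tyx * max (ty - tx) 0) (fy * (1 - r)) (fyh * tyx) (by positivity) (fun k => e0 k ω) (by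
      intro k
      by_cases hk : (k + 1) % (m + n) < m
      · rw [if_pos hk, (hX (k + 1) hk ω).2.2.2, add_sub_cancel_left]
        refine (tip_max _ _ _ _ _ (by positivity)).trans ?_
        rw [add_comm |_|]
        exact mul_le_mul_of_nonneg_left (exy k) (by positivity)
      · rw [if_neg hk, (hY (k + 1) hk ω).2.1]
        rw [add_sub_cancel_left, sub_self, abs_zero]
        exact mul_nonneg (by positivity) (ez k)) (fun i => φ i + 1) hφ1 lW
  have E1 := tip_eq (fun k => ax k ω) (fun k => bx k ω) (fun k => (hpos k ω).1)
    (fun k => (hpos k ω).2.1) (fun i => φ i + 1) (fun i => s (φ i)) _ _ tx lax lbx lRx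
  have E2 := tip_eq (fun k => ay k ω) (fun k => bY k ω) (fun k => (hpos k ω).2.2.1)
    (fun k => (hpos k ω).2.2.2) (fun i => φ i + 1) (fun i => s (φ i)) _ _ ty lay lbY lRy
  have hm0 : (0 : ℝ) < m := by exact_mod_cast hm
  have hn0 : (0 : ℝ) ≤ n := Nat.cast_nonneg n
  refine tip_alg ((m : ℝ) * sx * r) ((m : ℝ) * fx * (1 - r)) ((n : ℝ) * sy * r)
    ((n : ℝ) * fy * (1 - r)) ((n : ℝ) * txy * sxh) ((n : ℝ) * txy * fxh) ((m : ℝ) * tyx * syh)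
    ((m : ℝ) * tyx * fyh) tx ty (by positivity) (by positivity) ?_ (by positivity)
    (by positivity) (by positivity) (by positivity) hcase ?_ ?_
  · rcases Nat.eq_zero_or_pos n with h | h
    · left; simp [h]
    · right
      have : (0 : ℝ) < n := by exact_mod_cast h
      constructor <;> positivity
  · linarith only [E1]
  · linarith only [E2]
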